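/- arXiv:1611.05675 — 2 statements merged into one kernel-verified Lean document; each statement's English description precedes it below -/
import Mathlib

section
/- Suppose all bi-classifiers are correct for the target emotion e, i.e. r(e, j) = e for every emotion j ≠ e. Then for every emotion a ≠ e the vote count satisfies n_a ≤ M − 2, in particular n_a < M − 1. -/
/-- The vote count of emotion `a`: the number of unordered pairs `{i, j}` of
distinct emotions whose bi-classifier output `r i j` equals `a`. -/
def voteCount {E : Type*} [Fintype E] [DecidableEq E] (r : E → E → E) (a : E) : ℕ :=
  (Finset.univ.filter
    (fun s : Sym2 E => ¬ s.IsDiag ∧ ∃ i j : E, s = s(i, j) ∧ r i j = a)).card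

/-- If all bi-classifiers are correct for the target emotion `e`, then every
other emotion `a ≠ e` has vote count at most `M - 2`, in particular `< M - 1`. -/
theorem voteCount_lt_of_correct {E : Type*} [Fintype E] [DecidableEq E]
    (hM : 2 ≤ Fintype.card E)
    (r : E → E → E)
    (hsymm : ∀ i j : E, r i j = r j i)
    (hmem : ∀ i j : E, i ≠ j → r i j = i ∨ r i j = j)
    (e : E) (hcorrect : ∀ j : E, j ≠ e → r e j = e) :
    ∀ a : E, a ≠ e →
      voteCount r a ≤ Fintype.card E - 2 ∧ voteCount r a < Fintype.card E - 1 := by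
  intro a ha
  have hsub : (Finset.univ.filter
      (fun s : Sym2 E => ¬ s.IsDiag ∧ ∃ i j : E, s = s(i, j) ∧ r i j = a)) ⊆
      ((Finset.univ.erase e).erase a).image (fun j => s(a, j)) := by
    intro s hs
    obtain ⟨hdiag, i, j, rfl, hr⟩ := (Finset.mem_filter.mp hs).2
    have hij : i ≠ j := fun h => hdiag (Sym2.mk_isDiag_iff.mpr h)
    simp only [Finset.mem_image, Finset.mem_erase, Finset.mem_univ, and_true]
    rcases hmem i j hij with h | h
    · obtain rfl : i = a := h.symm.trans hr
      refine ⟨j, ⟨hij.symm, ?_⟩, rfl⟩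
      rintro rfl
      exact ha (by rw [← hr, hsymm, hcorrect i ha])
    · obtain rfl : j = a := h.symm.trans hr
      refine ⟨i, ⟨hij, ?_⟩, Sym2.eq_swap⟩
      rintro rfl
      exact ha (by rw [← hr, hcorrect j ha])
  have hle : voteCount r a ≤ ((Finset.univ.erase e).erase a).card :=
    (Finset.card_le_card hsub).trans Finset.card_image_le
  rw [Finset.card_erase_of_mem (by simp [ha]), Finset.card_erase_of_mem (Finset.mem_univ e),
    Finset.card_univ] at hle
  omega
end

section
/- (Full correctness of the voting decision algorithm including the competition stage) Let r be a bi-classifier assignment and let e be an emotion with r(e, j) = e for every j ≠ e. Let E_max be the set of emotions attaining the maximal vote count, enumerated as m_1, …, m_K, and let the algorithm output be m_1 if K = 1, and otherwise the result of iteratively setting e_m := m_1 and e_m := r(e_m, m_k) for k = 2, …, K. Then the algorithm outputs e. -/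
/-- Every emotion receives at most `M - 1` votes, one per pair containing it. -/
theorem voteCount_le {E : Type*} [Fintype E] [DecidableEq E] {r : E → E → E}
    (hmem : ∀ i j : E, i ≠ j → r i j = i ∨ r i j = j) (b : E) :
    voteCount r b ≤ Fintype.card E - 1 := by
  have hsub : Finset.univ.filter
      (fun s : Sym2 E => ¬ s.IsDiag ∧ ∃ i j : E, s = s(i, j) ∧ r i j = b) ⊆
      (Finset.univ.erase b).image (fun j => s(b, j)) := by
    intro s hs
    obtain ⟨hd, i, j, rfl, hij⟩ := (Finset.mem_filter.mp hs).2
    rw [Sym2.mk_isDiag_iff] at hd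
    simp only [Finset.mem_image, Finset.mem_erase, Finset.mem_univ, and_true]
    rcases hmem i j hd with h | h
    · obtain rfl : i = b := h.symm.trans hij
      exact ⟨j, Ne.symm hd, rfl⟩
    · obtain rfl : j = b := h.symm.trans hij
      exact ⟨i, hd, Sym2.eq_swap⟩
  calc voteCount r b ≤ ((Finset.univ.erase b).image (fun j => s(b, j))).card :=
        Finset.card_le_card hsub
    _ ≤ (Finset.univ.erase b).card := Finset.card_image_le
    _ = Fintype.card E - 1 := by
        rw [Finset.card_erase_of_mem (Finset.mem_univ b), Finset.card_univ]

/-- An emotion that wins all of its pairs receives at least `M - 1` votes. -/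
theorem le_voteCount_of_wins {E : Type*} [Fintype E] [DecidableEq E] {r : E → E → E}
    {e : E} (he : ∀ j : E, j ≠ e → r e j = e) :
    Fintype.card E - 1 ≤ voteCount r e := by
  have hinj : Function.Injective (fun j : E => s(e, j)) :=
    fun _ _ h => Sym2.congr_right.mp h
  rw [← Finset.card_univ, ← Finset.card_erase_of_mem (Finset.mem_univ e),
    ← Finset.card_image_of_injective _ hinj]
  refine Finset.card_le_card fun s hs => ?_
  obtain ⟨j, hj, rfl⟩ := Finset.mem_image.mp hs
  have hje : j ≠ e := Finset.ne_of_mem_erase hj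
  exact Finset.mem_filter.mpr ⟨Finset.mem_univ _,
    fun hd => hje (Sym2.mk_isDiag_iff.mp hd).symm, e, j, rfl, he j hje⟩

/-- Folding an operation over a list that meets an absorbing element yields that element. -/
theorem List.foldl_eq_of_absorbing {α : Type*} {f : α → α → α} {e : α}
    (hl : ∀ x, f e x = e) (hr : ∀ x, f x e = e) (l : List α) (m : α)
    (h : e = m ∨ e ∈ l) : l.foldl f m = e := by
  induction l generalizing m with
  | nil => simpa [eq_comm] using h
  | cons x l ih =>
    refine ih (f m x) ?_
    rcases h with rfl | h
    · exact Or.inl (hl x).symm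
    · rcases List.mem_cons.mp h with rfl | h
      · exact Or.inl (hr m).symm
      · exact Or.inr h

/-- Full correctness of the voting decision algorithm including the competition
stage: if `r e j = e` for every `j ≠ e`, and `m₁ :: rest` enumerates the set
`E_max` of emotions of maximal vote count, then the algorithm's output
(which is `m₁` when `rest = []`, i.e. `K = 1`, and otherwise the result of
iteratively setting `e_m := r e_m mₖ` starting from `e_m := m₁`) equals `e`. -/
theorem voting_algorithm_correct {E : Type*} [Fintype E] [DecidableEq E]
    (hM : 2 ≤ Fintype.card E)
    (r : E → E → E)
    (hsymm : ∀ i j : E, r i j = r j i)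
    (hmem : ∀ i j : E, i ≠ j → r i j = i ∨ r i j = j)
    (hdiag : ∀ a : E, r a a = a)
    (e : E) (hcorrect : ∀ j : E, j ≠ e → r e j = e) :
    ∀ (m : E) (rest : List E),
      (∀ a : E, (a = m ∨ a ∈ rest) ↔ ∀ b : E, voteCount r b ≤ voteCount r a) →
      rest.foldl r m = e := by
  intro m rest hmax
  have hl : ∀ x, r e x = e := fun x =>
    if hx : x = e then hx ▸ hdiag x else hcorrect x hx
  exact List.foldl_eq_of_absorbing hl (fun x => (hsymm x e).trans (hl x)) rest m <|
    (hmax e).mpr fun b => (voteCount_le hmem b).trans (le_voteCount_of_wins hcorrect)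
end
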